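/- Montgomery's conjecture is false: there exists a finite regular simple graph G such that χ₂(G) > χ(G) + 2. -/

import Mathlib

open SimpleGraph

/-- `c` is an `r`-dynamic colouring of `G` with colour set `[t] = {0, …, t-1}`:
a proper colouring such that at least `min r (deg v)` colours are used on the
neighbourhood of every vertex `v`. -/
def IsDynamicColoring {V : Type*} (G : SimpleGraph V) (r t : ℕ) (c : V → ℕ) : Prop :=
  (∀ v, c v < t) ∧ (∀ u v, G.Adj u v → c u ≠ c v) ∧
    ∀ v : V, min r (G.neighborSet v).ncard ≤ (c '' G.neighborSet v).ncard

/-- The `r`-dynamic chromatic number `χ_r(G)`: the least `t` admitting an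
`r`-dynamic colouring with `t` colours. -/
noncomputable def dynChromaticNumber {V : Type*} (G : SimpleGraph V) (r : ℕ) : ℕ :=
  sInf {t | ∃ c : V → ℕ, IsDynamicColoring G r t c}

/-- Vertices of the counterexample: `31` complete tripartite graphs with parts of size `435`, and
for each part index `i` one hub per three-element set of copies. -/
abbrev HubVertex : Type :=
  (Fin 31 × Fin 3 × Fin 435) ⊕ (Fin 3 × {T : Finset (Fin 31) // T.card = 3})

/-- Adjacency of the counterexample: inside a copy, vertices of different parts are adjacent; the
hub `(i, T)` is adjacent to the whole `i`-th part of each copy in `T`. -/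
def hubAdj : HubVertex → HubVertex → Prop
  | .inl (j, i, _), .inl (j', i', _) => j = j' ∧ i ≠ i'
  | .inl (j, i, _), .inr (i', T) => i = i' ∧ j ∈ T.1
  | .inr (i', T), .inl (j, i, _) => i = i' ∧ j ∈ T.1
  | .inr _, .inr _ => False

/-- The graph disproving Montgomery's conjecture. -/
def hubGraph : SimpleGraph HubVertex where
  Adj := hubAdj
  symm := ⟨by
    rintro (⟨j, i, k⟩ | ⟨i, T⟩) (⟨j', i', k'⟩ | ⟨i', T'⟩) h
    · exact ⟨h.1.symm, h.2.symm⟩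
    · exact h
    · exact h
    · exact h⟩
  loopless := ⟨by
    rintro (⟨j, i, k⟩ | ⟨i, T⟩) h
    · exact h.2 rfl
    · exact h⟩

theorem hubGraph_neighborSet_inl (j : Fin 31) (i : Fin 3) (k : Fin 435) :
    hubGraph.neighborSet (.inl (j, i, k)) =
      Sum.inl '' ({j} ×ˢ ({i}ᶜ ×ˢ Set.univ)) ∪ Sum.inr '' ({i} ×ˢ {T | j ∈ T.1}) := by
  ext (⟨j', i', k'⟩ | ⟨i', T'⟩)
  · simp [hubGraph, hubAdj, eq_comm]
  · simp [hubGraph, hubAdj, eq_comm]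

theorem hubGraph_neighborSet_inr (i : Fin 3) (T : {T : Finset (Fin 31) // T.card = 3}) :
    hubGraph.neighborSet (.inr (i, T)) =
      Sum.inl '' ((T.1 : Set (Fin 31)) ×ˢ ({i} ×ˢ Set.univ)) := by
  ext (⟨j', i', k'⟩ | ⟨i', T'⟩)
  · simp [hubGraph, hubAdj, and_comm]
  · simp [hubGraph, hubAdj]

theorem ncard_setOf_mem_of_card_eq_succ {α : Type*} [Fintype α] (n : ℕ) (a : α) :
    {T : {T : Finset α // T.card = n + 1} | a ∈ T.1}.ncard =
      (Fintype.card α - 1).choose n := by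
  classical
  rw [← Set.ncard_image_of_injective _ Subtype.val_injective]
  have h : Subtype.val '' {T : {T : Finset α // T.card = n + 1} | a ∈ T.1} =
      ((((Finset.univ.erase a).powersetCard n).image (insert a) : Finset (Finset α)) :
        Set (Finset α)) := by
    ext T
    simp only [Set.mem_image, Set.mem_ofPred_eq, Subtype.exists, exists_and_right, exists_eq_right,
      Finset.coe_image, Finset.mem_coe, Finset.mem_powersetCard]
    constructor
    · rintro ⟨hT, ha⟩
      refine ⟨T.erase a, ⟨Finset.erase_subset_erase a (Finset.subset_univ T), ?_⟩,
        Finset.insert_erase ha⟩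
      rw [Finset.card_erase_of_mem ha, hT, Nat.add_sub_cancel]
    · rintro ⟨U, ⟨hU, hn⟩, rfl⟩
      have ha : a ∉ U := fun h => Finset.notMem_erase a _ (hU h)
      exact ⟨by rw [Finset.card_insert_of_notMem ha, hn], Finset.mem_insert_self a U⟩
  rw [h, Set.ncard_coe_finset, Finset.card_image_of_injOn, Finset.card_powersetCard,
    Finset.card_erase_of_mem (Finset.mem_univ a), Finset.card_univ]
  intro U hU W hW hUW
  have key : ∀ X ∈ (Finset.univ.erase a).powersetCard n, a ∉ X := fun X hX h =>
    Finset.notMem_erase a _ ((Finset.mem_powersetCard.1 hX).1 h)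
  rw [← Finset.erase_insert (key U hU), ← Finset.erase_insert (key W hW)]
  exact congrArg (Finset.erase · a) hUW

theorem hubGraph_ncard_neighborSet (v : HubVertex) : (hubGraph.neighborSet v).ncard = 1305 := by
  rcases v with ⟨j, i, k⟩ | ⟨i, T, hT⟩
  · rw [hubGraph_neighborSet_inl, Set.ncard_union_eq (by simp [Set.disjoint_left]),
      Set.ncard_image_of_injective _ Sum.inl_injective,
      Set.ncard_image_of_injective _ Sum.inr_injective, Set.ncard_prod, Set.ncard_prod,
      Set.ncard_prod, ncard_setOf_mem_of_card_eq_succ 2 j, Set.ncard_compl]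
    simp [Nat.choose]
  · rw [hubGraph_neighborSet_inr, Set.ncard_image_of_injective _ Sum.inl_injective,
      Set.ncard_prod, Set.ncard_prod, Set.ncard_coe_finset, hT]
    simp

theorem hubGraph_colorable : hubGraph.Colorable 3 := by
  refine ⟨Coloring.mk (Sum.elim (fun x => x.2.1) fun x => x.1 + 1) ?_⟩
  rintro (⟨j, i, k⟩ | ⟨i, T⟩) (⟨j', i', k'⟩ | ⟨i', T'⟩) h
  · exact h.2
  · obtain ⟨rfl, -⟩ := h
    simp
  · obtain ⟨rfl, -⟩ := h
    simp
  · exact h.elim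

/-- In a proper colouring with five colours, every copy has a monochromatic part. -/
theorem hubGraph_exists_monochromatic_part (c : HubVertex → Fin 5)
    (hc : ∀ u v, hubGraph.Adj u v → c u ≠ c v) (j : Fin 31) :
    ∃ p : Fin 3 × Fin 5, ∀ k, c (.inl (j, p.1, k)) = p.2 := by
  by_contra! h
  choose k hk using fun i => h (i, c (.inl (j, i, 0)))
  let f : Fin 3 × Bool → Fin 5 := fun x => c (.inl (j, x.1, if x.2 then k x.1 else 0))
  have hf : Function.Injective f := by
    rintro ⟨i, b⟩ ⟨i', b'⟩ hx
    by_cases hi : i = i'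
    · subst hi
      have h0 := hk i
      cases b <;> cases b' <;> simp only [f, if_true, if_false, Bool.false_eq_true] at hx
      · rfl
      · exact absurd hx.symm h0
      · exact absurd hx h0
      · rfl
    · exact absurd hx (hc _ _ ⟨rfl, hi⟩)
  simpa using Fintype.card_le_of_injective f hf

theorem hubGraph_exists_monochromatic_neighborSet (c : HubVertex → Fin 5)
    (hc : ∀ u v, hubGraph.Adj u v → c u ≠ c v) :
    ∃ v a, ∀ u ∈ hubGraph.neighborSet v, c u = a := by
  choose p hp using hubGraph_exists_monochromatic_part c hc
  obtain ⟨⟨i, a⟩, hy⟩ := Fintype.exists_lt_card_fiber_of_mul_lt_card (n := 2) p (by simp)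
  obtain ⟨T, hT, hT3⟩ := Finset.exists_subset_card_eq (Nat.succ_le_of_lt hy)
  refine ⟨.inr (i, ⟨T, hT3⟩), a, ?_⟩
  rw [hubGraph_neighborSet_inr]
  rintro _ ⟨⟨j, i', k⟩, ⟨hj, hi, -⟩, rfl⟩
  obtain rfl : i' = i := hi
  have hpj : p j = (i', a) := (Finset.mem_filter.1 (hT hj)).2
  simpa [hpj] using hp j k

theorem hubGraph_not_isDynamicColoring {t : ℕ} (ht : t ≤ 5) (c : HubVertex → ℕ) :
    ¬ IsDynamicColoring hubGraph 2 t c := by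
  rintro ⟨hlt, hne, hdyn⟩
  obtain ⟨v, a, hv⟩ := hubGraph_exists_monochromatic_neighborSet
    (fun v => ⟨c v, (hlt v).trans_le ht⟩) fun u v h he => hne u v h (congrArg Fin.val he)
  have hsub : c '' hubGraph.neighborSet v ⊆ {a.1} := by
    rintro _ ⟨u, hu, rfl⟩
    exact congrArg Fin.val (hv u hu)
  have h1 := Set.ncard_le_ncard hsub
  have h2 := hdyn v
  rw [hubGraph_ncard_neighborSet] at h2
  rw [Set.ncard_singleton] at h1
  omega

theorem SimpleGraph.Iso.ncard_neighborSet {V W : Type*} {G : SimpleGraph V} {H : SimpleGraph W}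
    (e : G ≃g H) (v : V) : (H.neighborSet (e v)).ncard = (G.neighborSet v).ncard := by
  rw [← e.image_neighborSet, Set.ncard_image_of_injective _ e.injective]

theorem IsDynamicColoring.comp_iso {V W : Type*} {G : SimpleGraph V} {H : SimpleGraph W}
    {r t : ℕ} {c : W → ℕ} (hc : IsDynamicColoring H r t c) (e : G ≃g H) :
    IsDynamicColoring G r t (c ∘ e) := by
  refine ⟨fun v => hc.1 _, fun u v h => hc.2.1 _ _ (e.map_adj_iff.2 h), fun v => ?_⟩
  rw [Set.image_comp, e.image_neighborSet, ← e.ncard_neighborSet]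
  exact hc.2.2 _

theorem isDynamicColoring_val {t : ℕ} (G : SimpleGraph (Fin t)) (r : ℕ) :
    IsDynamicColoring G r t Fin.val :=
  ⟨fun v => v.2, fun _ _ h he => h.ne (Fin.ext he), fun v => by
    rw [Set.ncard_image_of_injective _ Fin.val_injective]
    exact min_le_right _ _⟩

/-- Montgomery's conjecture (`χ₂(G) ≤ χ(G) + 2` for regular `G`) is false. -/
theorem stmt2 :
    ∃ (t : ℕ) (G : SimpleGraph (Fin t)) (d : ℕ),
      (∀ v, (G.neighborSet v).ncard = d) ∧
      G.chromaticNumber + 2 < (dynChromaticNumber G 2 : ℕ∞) := by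
  let f : HubVertex ≃ Fin (Fintype.card HubVertex) := Fintype.equivFin _
  let G := hubGraph.comap f.symm
  let e : G ≃g hubGraph := Iso.comap f.symm hubGraph
  refine ⟨_, G, 1305, fun v => ?_, ?_⟩
  · rw [← e.ncard_neighborSet, hubGraph_ncard_neighborSet]
  · obtain ⟨c, hc⟩ : ∃ c, IsDynamicColoring G 2 (dynChromaticNumber G 2) c :=
      Nat.sInf_mem (s := {t | ∃ c, IsDynamicColoring G 2 t c}) ⟨_, _, isDynamicColoring_val G 2⟩
    have h5 : 5 < dynChromaticNumber G 2 := by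
      by_contra! h
      exact hubGraph_not_isDynamicColoring h _ (hc.comp_iso e.symm)
    have h3 : G.chromaticNumber ≤ 3 := (hubGraph_colorable.of_hom e.toHom).chromaticNumber_le
    calc G.chromaticNumber + 2 ≤ 3 + 2 := by gcongr
      _ = ((5 : ℕ) : ℕ∞) := by norm_num
      _ < _ := by exact_mod_cast h5
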